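/- arXiv:1504.04966 — 2 statements merged into one kernel-verified Lean document; each statement's English description precedes it below -/
import Mathlib

section
/- Let β > 1 have eventually periodic generating sequence g(β), with n ≥ 0 and p ≥ 1 minimal such that g(β) = g_1 ⋯ g_n (g_{n+1} ⋯ g_{n+p})^∞, and let F_β be the Fischer graph. If λ is a finite path in F_β starting at vertex 1 whose label word w = w_1 ⋯ w_m is not a factor of g(β) (i.e., there is no j ≥ 1 with g_{j+i−1} = w_i for all 1 ≤ i ≤ m), then every finite path in F_β labeled w terminates at the same vertex as λ. -/
/-- The remainders `r_n(t)` of the β-expansion of `t` (0-indexed: `betaRem β t n = r_n(t)`). -/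
noncomputable def betaRem (β t : ℝ) : ℕ → ℝ
  | 0 => t
  | n + 1 => Int.fract (β * betaRem β t n)

/-- `betaDigit β t n` is the digit `x_{n+1}(t)` of the β-expansion of `t` (0-indexed). -/
noncomputable def betaDigit (β t : ℝ) (n : ℕ) : ℕ :=
  (⌊β * betaRem β t n⌋).toNat

/- The generating sequence `g(β)`, 0-indexed: `genSeq β i = g_{i+1}`.
If `e(β)` is eventually zero with last nonzero digit at (0-indexed) position `k`,
then `g(β)` is the periodic sequence of period `k+1` obtained from the initial word
of `e(β)` of length `k+1` by decreasing its last letter by one; otherwise `g(β) = e(β)`. -/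
open scoped Classical in
noncomputable def genSeq (β : ℝ) : ℕ → ℕ :=
  if h : ∃ k, betaDigit β 1 k ≠ 0 ∧ ∀ m, k < m → betaDigit β 1 m = 0 then
    fun i =>
      if i % (Nat.find h + 1) = Nat.find h then betaDigit β 1 (Nat.find h) - 1
      else betaDigit β 1 (i % (Nat.find h + 1))
  else
    betaDigit β 1

/-- Strict lexicographic order on one-sided sequences. -/
def lexLt (x y : ℕ → ℕ) : Prop :=
  ∃ n, (∀ i < n, x i = y i) ∧ x n < y n

/-- Lexicographic order on one-sided sequences. -/
def lexLe (x y : ℕ → ℕ) : Prop :=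
  x = y ∨ lexLt x y

/-- Membership in the beta-shift `X_β` (bi-infinite sequences). -/
def memBeta (β : ℝ) (x : ℤ → ℕ) : Prop :=
  ∀ k : ℤ, lexLe (fun n : ℕ => x (k + n)) (genSeq β)

/-- Membership in the right-ray space `X_β⁺`. -/
def rightRay (β : ℝ) (x : ℕ → ℕ) : Prop :=
  ∀ k : ℕ, lexLe (fun n : ℕ => x (k + n)) (genSeq β)

/-- The edge relation of the Fischer graph `F_β` of a sofic beta-shift whose generating
sequence is `g = g_1 g_2 ⋯` (0-indexed: `g i = g_{i+1}`) with minimal decomposition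
`g(β) = g_1 ⋯ g_n (g_{n+1} ⋯ g_{n+p})^∞`.  `fischerEdge g n p a i j` says that there is
an edge labeled `a` from vertex `i` to vertex `j` (vertices are `1, …, n+p`). -/
def fischerEdge (g : ℕ → ℕ) (n p : ℕ) (a i j : ℕ) : Prop :=
  1 ≤ i ∧ i ≤ n + p ∧
    ((a < g (i - 1) ∧ j = 1) ∨
     (a = g (i - 1) ∧ i < n + p ∧ j = i + 1) ∨
     (a = g (i - 1) ∧ i = n + p ∧ j = n + 1))

theorem betaRem_nonneg (β : ℝ) {t : ℝ} (ht : 0 ≤ t) (k : ℕ) : 0 ≤ betaRem β t k := by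
  cases k with
  | zero => exact ht
  | succ k => exact Int.fract_nonneg _

theorem betaRem_le_one (β : ℝ) {t : ℝ} (ht : t ≤ 1) (k : ℕ) : betaRem β t k ≤ 1 := by
  cases k with
  | zero => exact ht
  | succ k => exact (Int.fract_lt_one _).le

theorem betaDigit_add_betaRem_succ {β t : ℝ} (hβ : 0 ≤ β) (ht : 0 ≤ t) (k : ℕ) :
    (betaDigit β t k : ℝ) + betaRem β t (k + 1) = β * betaRem β t k := by
  have h : (0 : ℤ) ≤ ⌊β * betaRem β t k⌋ :=
    Int.floor_nonneg.2 (mul_nonneg hβ (betaRem_nonneg β ht k))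
  have hcast : (betaDigit β t k : ℝ) = (⌊β * betaRem β t k⌋ : ℝ) := by
    rw [betaDigit, ← Int.cast_natCast, Int.toNat_of_nonneg h]
  rw [hcast]
  exact Int.floor_add_fract _

theorem betaRem_eq_zero_of_le {β t : ℝ} {j k : ℕ} (hj : betaRem β t j = 0) (hjk : j ≤ k) :
    betaRem β t k = 0 := by
  induction k, hjk using Nat.le_induction with
  | base => exact hj
  | succ k _ ih => simp [betaRem, ih]

theorem betaDigit_eq_zero_of_betaRem_eq_zero {β t : ℝ} {j k : ℕ} (hj : betaRem β t j = 0)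
    (hjk : j ≤ k) : betaDigit β t k = 0 := by
  simp [betaDigit, betaRem_eq_zero_of_le hj hjk]

/-- If all digits from position `j` on vanish, so does the remainder at `j`. -/
theorem betaRem_eq_zero_of_betaDigit_eq_zero {β t : ℝ} (hβ : 1 < β) (ht : 0 ≤ t) (ht' : t ≤ 1)
    {j : ℕ} (hj : ∀ k, j ≤ k → betaDigit β t k = 0) : betaRem β t j = 0 := by
  have hpow : ∀ i, betaRem β t (j + i) = β ^ i * betaRem β t j := by
    intro i
    induction i with
    | zero => simp
    | succ i ih =>
      have h := betaDigit_add_betaRem_succ (by linarith : (0 : ℝ) ≤ β) ht (j + i)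
      rw [hj _ (Nat.le_add_right j i), ih] at h
      rw [← add_assoc, pow_succ]
      push_cast at h
      linarith
  by_contra hne
  have hpos : 0 < betaRem β t j := lt_of_le_of_ne (betaRem_nonneg β ht j) (Ne.symm hne)
  obtain ⟨i, hi⟩ := pow_unbounded_of_one_lt (1 / betaRem β t j) hβ
  rw [div_lt_iff₀ hpos, ← hpow] at hi
  exact absurd (betaRem_le_one β ht' (j + i)) (not_le.2 hi)

theorem betaDigit_one_zero_ne_zero {β : ℝ} (hβ : 1 < β) : betaDigit β 1 0 ≠ 0 := by
  have h : (1 : ℤ) ≤ ⌊β * betaRem β 1 0⌋ := by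
    rw [Int.le_floor]
    simp [betaRem, hβ.le]
  rw [betaDigit]
  omega

/-- If some remainder of `1` vanishes, then the expansion of `1` has a last nonzero digit. -/
theorem exists_last_betaDigit_of_betaRem_eq_zero {β : ℝ} (hβ : 1 < β) {j : ℕ}
    (hj : betaRem β 1 j = 0) :
    ∃ k, betaDigit β 1 k ≠ 0 ∧ ∀ m, k < m → betaDigit β 1 m = 0 := by
  classical
  refine ⟨Nat.findGreatest (fun k => betaDigit β 1 k ≠ 0) j, ?_, fun m hm => ?_⟩
  · exact Nat.findGreatest_spec (P := fun k => betaDigit β 1 k ≠ 0) (Nat.zero_le j)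
      (betaDigit_one_zero_ne_zero hβ)
  · rcases le_total m j with h | h
    · exact not_not.1 (Nat.findGreatest_is_greatest hm h)
    · exact betaDigit_eq_zero_of_betaRem_eq_zero hj h

/-- The generating sequence is the quasi-greedy expansion of `1`: its remainders can be
taken in `(0, 1]`. -/
theorem exists_genSeq_remainders {β : ℝ} (hβ : 1 < β) :
    ∃ q : ℕ → ℝ, q 0 = 1 ∧ (∀ k, 0 < q k) ∧ (∀ k, q k ≤ 1) ∧
      ∀ k, (genSeq β k : ℝ) + q (k + 1) = β * q k := by
  classical
  have hβ0 : (0 : ℝ) ≤ β := by linarith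
  by_cases h : ∃ k, betaDigit β 1 k ≠ 0 ∧ ∀ m, k < m → betaDigit β 1 m = 0
  · obtain ⟨K, hK, hne, hzero⟩ : ∃ K, K = Nat.find h ∧ betaDigit β 1 K ≠ 0 ∧
        ∀ m, K < m → betaDigit β 1 m = 0 := ⟨_, rfl, Nat.find_spec h⟩
    have hg : ∀ i, genSeq β i = if i % (K + 1) = K then betaDigit β 1 K - 1
        else betaDigit β 1 (i % (K + 1)) := by
      intro i
      rw [genSeq, dif_pos h, hK]
    have hmod : ∀ k, k % (K + 1) ≤ K := fun k => Nat.lt_succ_iff.1 (Nat.mod_lt _ K.succ_pos)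
    refine ⟨fun i => betaRem β 1 (i % (K + 1)), by simp [betaRem], fun k => ?_,
      fun k => betaRem_le_one β le_rfl _, fun k => ?_⟩
    · refine lt_of_le_of_ne (betaRem_nonneg β zero_le_one _) fun h0 => hne ?_
      exact betaDigit_eq_zero_of_betaRem_eq_zero h0.symm (hmod k)
    · have hrec := betaDigit_add_betaRem_succ hβ0 zero_le_one (k % (K + 1))
      rw [hg]
      split_ifs with hk
      · have hk' : (k + 1) % (K + 1) = 0 := by
          rw [← Nat.mod_add_mod, hk, Nat.mod_self]
        have hr : betaRem β 1 (K + 1) = 0 :=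
          betaRem_eq_zero_of_betaDigit_eq_zero hβ zero_le_one le_rfl fun m hm => hzero m hm
        rw [hk, hr] at hrec
        simp only [hk, hk']
        rw [← hrec, Nat.cast_sub (Nat.one_le_iff_ne_zero.2 hne)]
        simp [betaRem]
      · have hk' : (k + 1) % (K + 1) = k % (K + 1) + 1 := by
          rw [← Nat.mod_add_mod]
          have := hmod k
          exact Nat.mod_eq_of_lt (by omega)
        simp only [hk']
        exact hrec
  · have hg : genSeq β = betaDigit β 1 := by rw [genSeq, dif_neg h]
    refine ⟨betaRem β 1, rfl, fun k => ?_, betaRem_le_one β le_rfl, fun k => ?_⟩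
    · exact lt_of_le_of_ne (betaRem_nonneg β zero_le_one k) fun h0 =>
        h (exists_last_betaDigit_of_betaRem_eq_zero hβ h0.symm)
    · rw [hg]
      exact betaDigit_add_betaRem_succ hβ0 zero_le_one k

/-- No shift of the generating sequence is lexicographically larger than it. -/
theorem not_lexLt_genSeq_shift {β : ℝ} (hβ : 1 < β) (k : ℕ) :
    ¬ lexLt (genSeq β) (fun i => genSeq β (k + i)) := by
  rintro ⟨m, heq, hlt⟩
  obtain ⟨q, hq0, hpos, hle, hrec⟩ := exists_genSeq_remainders hβ
  have hβ0 : (0 : ℝ) ≤ β := by linarith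
  have hmono : ∀ i ≤ m, q (k + i) ≤ q i := by
    intro i
    induction i with
    | zero => intro _; rw [hq0]; exact hle _
    | succ i ih =>
      intro hi
      have h1 := hrec i
      have h2 := hrec (k + i)
      have h3 := mul_le_mul_of_nonneg_left (ih (by omega)) hβ0
      have h4 : genSeq β i = genSeq β (k + i) := heq i (by omega)
      rw [← h4] at h2
      rw [← add_assoc]
      linarith
  have h1 := hrec m
  have h2 := hrec (k + m)
  have h3 := mul_le_mul_of_nonneg_left (hmono m le_rfl) hβ0
  have h4 : (genSeq β m : ℝ) + 1 ≤ genSeq β (k + m) := by exact_mod_cast hlt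
  linarith [hle (m + 1), hpos (k + m + 1)]

/-- The Fischer graph is right-resolving. -/
theorem fischerEdge_target_unique {g : ℕ → ℕ} {n p a i j j' : ℕ} (h : fischerEdge g n p a i j)
    (h' : fischerEdge g n p a i j') : j = j' := by
  obtain ⟨_, _, h⟩ := h
  obtain ⟨_, _, h'⟩ := h'
  omega

/-- An edge that does not read a letter smaller than the one at its source advances by one
position along the generating sequence. -/
theorem fischerEdge_advance {g : ℕ → ℕ} {n p a i j : ℕ}
    (hper : ∀ k, n ≤ k → g (k + p) = g k)
    (h : fischerEdge g n p a i j) (ha : ¬ a < g (i - 1)) :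
    a = g (i - 1) ∧ ∀ k, g (j - 1 + k) = g (i - 1 + (k + 1)) := by
  obtain ⟨hi, _, ⟨hlt, _⟩ | ⟨ha, _, rfl⟩ | ⟨ha, rfl, rfl⟩⟩ := h
  · exact absurd hlt ha
  · exact ⟨ha, fun k => congrArg g (by omega)⟩
  · refine ⟨ha, fun k => ?_⟩
    rw [show n + p - 1 + (k + 1) = n + k + p by omega, hper _ (Nat.le_add_right n k)]
    exact congrArg g (by omega)

/-- A path starting at vertex `1` records a suffix of its label which is a prefix of `g`. -/
theorem fischerEdge_path_suffix {g : ℕ → ℕ} {n p : ℕ}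
    (hper : ∀ k, n ≤ k → g (k + p) = g k) {f v : ℕ → ℕ} {N : ℕ} (hv0 : v 0 = 1)
    (hv : ∀ i < N, fischerEdge g n p (f i) (v i) (v (i + 1))) (t : ℕ) (ht : t ≤ N) :
    ∃ L ≤ t, (∀ i < L, f (t - L + i) = g i) ∧ (∀ k, g (v t - 1 + k) = g (L + k)) ∧
      (L = 0 → v t = 1) := by
  induction t with
  | zero => exact ⟨0, le_rfl, by simp, by simp [hv0], fun _ => hv0⟩
  | succ t ih =>
    obtain ⟨L, hL, hf, hg, -⟩ := ih (by omega)
    have he := hv t ht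
    by_cases ha : f t < g (v t - 1)
    · have h1 : v (t + 1) = 1 := by
        obtain ⟨_, _, h⟩ := he
        omega
      exact ⟨0, Nat.zero_le _, by simp, by simp [h1], fun _ => h1⟩
    · obtain ⟨ha', hadv⟩ := fischerEdge_advance hper he ha
      refine ⟨L + 1, by omega, fun i hi => ?_, fun k => ?_, fun h => by omega⟩
      · rcases Nat.lt_succ_iff_lt_or_eq.1 hi with h | rfl
        · rw [← hf i h]
          exact congrArg f (by omega)
        · rw [show t + 1 - (i + 1) + i = t by omega, ha']
          exact hg 0
      · rw [hadv, hg]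
        exact congrArg g (by omega)

/-- A path that never reads a letter smaller than the one at its current vertex follows `g`. -/
theorem fischerEdge_path_follows {g : ℕ → ℕ} {n p : ℕ}
    (hper : ∀ k, n ≤ k → g (k + p) = g k) {f v : ℕ → ℕ} {N : ℕ}
    (hv : ∀ i < N, fischerEdge g n p (f i) (v i) (v (i + 1)))
    (hge : ∀ i < N, ¬ f i < g (v i - 1)) (t : ℕ) (ht : t ≤ N) :
    (∀ i < t, g (v 0 - 1 + i) = f i) ∧ ∀ k, g (v t - 1 + k) = g (v 0 - 1 + (t + k)) := by
  induction t with
  | zero => simp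
  | succ t ih =>
    obtain ⟨hf, hg⟩ := ih (by omega)
    obtain ⟨ha, hadv⟩ := fischerEdge_advance hper (hv t ht) (hge t ht)
    refine ⟨fun i hi => ?_, fun k => ?_⟩
    · rcases Nat.lt_succ_iff_lt_or_eq.1 hi with h | rfl
      · exact hf i h
      · rw [ha]
        exact (hg 0).symm
    · rw [hadv, hg]
      exact congrArg g (by omega)

/-- if `λ` is a finite path in the Fischer graph `F_β` starting at vertex `1`
whose label word `w` is not a factor of `g(β)`, then every finite path in `F_β` labeled `w`
terminates at the same vertex as `λ`. -/
theorem statement7 (β : ℝ) (hβ : 1 < β) (n p : ℕ) (hp : 1 ≤ p)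
    (hper : ∀ k, n ≤ k → genSeq β (k + p) = genSeq β k)
    (hmin : ∀ n' p' : ℕ, 1 ≤ p' →
      (∀ k, n' ≤ k → genSeq β (k + p') = genSeq β k) → n ≤ n' ∧ p ≤ p')
    (w : List ℕ)
    (hw : ¬ ∃ j : ℕ, ∀ i < w.length, genSeq β (j + i) = w.getD i 0)
    (v : ℕ → ℕ) (hv0 : v 0 = 1)
    (hv : ∀ i < w.length, fischerEdge (genSeq β) n p (w.getD i 0) (v i) (v (i + 1)))
    (v' : ℕ → ℕ)
    (hv' : ∀ i < w.length, fischerEdge (genSeq β) n p (w.getD i 0) (v' i) (v' (i + 1))) :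
    v' w.length = v w.length := by
  classical
  have hdrop : ∃ t, t < w.length ∧ w.getD t 0 < genSeq β (v' t - 1) := by
    by_contra hno
    push Not at hno
    exact hw ⟨v' 0 - 1, (fischerEdge_path_follows hper hv'
      (fun i hi => not_lt.2 (hno i hi)) w.length le_rfl).1⟩
  obtain ⟨T, ⟨hTN, hlt⟩, hmin_T⟩ : ∃ T, (T < w.length ∧ w.getD T 0 < genSeq β (v' T - 1)) ∧
      ∀ t < T, ¬ (t < w.length ∧ w.getD t 0 < genSeq β (v' t - 1)) :=
    ⟨Nat.find hdrop, Nat.find_spec hdrop, fun t ht => Nat.find_min hdrop ht⟩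
  obtain ⟨hf, hg⟩ := fischerEdge_path_follows (N := T) hper (fun i hi => hv' i (by omega))
    (fun i hi h => hmin_T i hi ⟨by omega, h⟩) T le_rfl
  have hreturn' : v' (T + 1) = 1 := by
    obtain ⟨_, _, h⟩ := hv' T hTN
    omega
  have hreturn : v (T + 1) = 1 := by
    obtain ⟨L, hL, hpre, -, hL0⟩ := fischerEdge_path_suffix (f := fun i => w.getD i 0)
      hper hv0 hv (T + 1) hTN
    rcases Nat.eq_zero_or_pos L with h | hpos
    · exact hL0 h
    refine absurd ⟨L - 1, fun i hi => ?_, ?_⟩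
      (not_lexLt_genSeq_shift hβ (v' 0 - 1 + (T + 1 - L)))
    · beta_reduce
      rw [← hpre i (by omega), add_assoc]
      exact (hf _ (by omega)).symm
    · have h0 := hg 0
      rw [add_zero, add_zero] at h0
      rw [h0, show T = T + 1 - L + (L - 1) by omega] at hlt
      beta_reduce
      rw [← hpre (L - 1) (by omega), add_assoc]
      exact hlt
  have hagree : ∀ t, T + 1 ≤ t → t ≤ w.length → v' t = v t := by
    intro t ht
    induction t, ht using Nat.le_induction with
    | base => intro _; rw [hreturn, hreturn']
    | succ t _ ih =>
      intro htN
      have he := hv' t htN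
      rw [ih (by omega)] at he
      exact fischerEdge_target_unique he (hv t htN)
  exact hagree w.length hTN le_rfl
end

section
/- Let β > 1 have generating sequence g(β) that is eventually periodic but not periodic, with n ≥ 1 and p ≥ 1 minimal such that g(β) = g_1 ⋯ g_n (g_{n+1} ⋯ g_{n+p})^∞. Then: (a) every x ∈ X_β admits at most two presentations in the Fischer graph F_β; (b) if x admits two distinct presentations, then there exists k ∈ ℤ such that x_{k−j} = g_{n+p−(j mod p)} for all j ≥ 0 (i.e., the left tail of x ending at position k is the left-infinite periodic sequence (g_{n+1} ⋯ g_{n+p})^∞); and (c) the bi-infinite periodic point x given by x_i = g_{n+1+(i mod p)} for all i ∈ ℤ admits exactly two presentations. -/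
/-- Every shift of `e(β)` is lexicographically at most `e(β)`: at the
first place where a shift can differ, it has the smaller digit. -/
theorem betaDigit_add_le {β : ℝ} (hβ : 1 < β) (m e : ℕ)
    (h : ∀ j < e, betaDigit β 1 (m + j) = betaDigit β 1 j) :
    betaDigit β 1 (m + e) ≤ betaDigit β 1 e := by
  have hβ0 : 0 ≤ β := by linarith
  have hr : ∀ k, 0 ≤ betaRem β 1 k ∧ betaRem β 1 k ≤ 1 := by
    intro k
    cases k with
    | zero => simp [betaRem]
    | succ k => exact ⟨Int.fract_nonneg _, (Int.fract_lt_one _).le⟩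
  have hrem : ∀ j ≤ e, betaRem β 1 (m + j) ≤ betaRem β 1 j := by
    intro j
    induction j with
    | zero => intro _; simpa [betaRem] using (hr m).2
    | succ j ih =>
      intro hj
      have h1 := mul_le_mul_of_nonneg_left (ih (by omega)) hβ0
      have h2 := h j (by omega)
      have h3 : ⌊β * betaRem β 1 (m + j)⌋ = ⌊β * betaRem β 1 j⌋ := by
        have p1 : 0 ≤ ⌊β * betaRem β 1 (m + j)⌋ := Int.floor_nonneg.2 (mul_nonneg hβ0 (hr _).1)
        have p2 : 0 ≤ ⌊β * betaRem β 1 j⌋ := Int.floor_nonneg.2 (mul_nonneg hβ0 (hr _).1)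
        unfold betaDigit at h2
        omega
      change Int.fract (β * betaRem β 1 (m + j)) ≤ Int.fract (β * betaRem β 1 j)
      simp only [Int.fract, h3]
      linarith
  exact Int.toNat_le_toNat
    (Int.floor_le_floor (mul_le_mul_of_nonneg_left (hrem e le_rfl) hβ0))

/-- A generating sequence that is not purely periodic is the β-expansion of `1`. -/
theorem genSeq_eq_betaDigit {β : ℝ}
    (h : ∀ q, 1 ≤ q → ¬ ∀ k, genSeq β (k + q) = genSeq β k) :
    genSeq β = betaDigit β 1 := by
  classical
  by_cases hk : ∃ k, betaDigit β 1 k ≠ 0 ∧ ∀ m, k < m → betaDigit β 1 m = 0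
  · refine absurd (fun k => ?_) (h (Nat.find hk + 1) (by omega))
    simp only [genSeq, dif_pos hk, Nat.add_mod_right]
  · simp only [genSeq, dif_neg hk]

/-- The vertex of the Fischer graph reached from vertex `1` by reading `g_1 ⋯ g_d`. -/
def fischerState (n p d : ℕ) : ℕ :=
  if d < n then d + 1 else n + 1 + (d - n) % p

section FischerGraph

variable {g : ℕ → ℕ} {n p : ℕ} {x : ℤ → ℕ} {v w : ℤ → ℕ}

theorem fischerState_zero (hn : 1 ≤ n) : fischerState n p 0 = 1 := by
  simp [fischerState, show 0 < n by omega]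

theorem eq_zero_of_fischerState_eq_one (hn : 1 ≤ n) {d : ℕ} (h : fischerState n p d = 1) :
    d = 0 := by
  unfold fischerState at h
  split_ifs at h <;> omega

theorem fischerState_pred {i : ℕ} (h1 : 1 ≤ i) (h2 : i ≤ n + p) :
    fischerState n p (i - 1) = i := by
  unfold fischerState
  split_ifs with h
  · omega
  · rw [Nat.mod_eq_of_lt (by omega)]
    omega

theorem apply_add_mul_period (hper : ∀ k, n ≤ k → g (k + p) = g k) {k : ℕ} (hk : n ≤ k) (q : ℕ) :
    g (k + q * p) = g k := by
  induction q with
  | zero => simp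
  | succ q ih => rw [Nat.succ_mul, ← add_assoc, hper _ (by omega), ih]

theorem apply_eq_of_dvd_sub (hper : ∀ k, n ≤ k → g (k + p) = g k) {a b : ℕ}
    (ha : n ≤ a) (hb : n ≤ b) (h : (p : ℤ) ∣ (a : ℤ) - b) : g a = g b := by
  wlog hab : b ≤ a generalizing a b
  · exact (this hb ha ((dvd_sub_comm).1 h) (by omega)).symm
  rw [← Nat.cast_sub hab, Int.natCast_dvd_natCast] at h
  obtain ⟨q, hq⟩ := h
  rw [show a = b + q * p by rw [mul_comm q p]; omega, apply_add_mul_period hper hb]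

theorem fischerEdge_fischerState (hp : 1 ≤ p) (hper : ∀ k, n ≤ k → g (k + p) = g k) {a d j : ℕ} :
    fischerEdge g n p a (fischerState n p d) j ↔
      (a < g d ∧ j = 1) ∨ (a = g d ∧ j = fischerState n p (d + 1)) := by
  have hmod := Nat.mod_lt (d - n) hp
  have hg : g (fischerState n p d - 1) = g d := by
    unfold fischerState
    split_ifs with h
    · rfl
    · refine apply_eq_of_dvd_sub hper (by omega) (by omega) ?_
      have := Nat.div_add_mod (d - n) p
      generalize (d - n) / p = q at *
      generalize (d - n) % p = r at *
      refine ⟨-q, ?_⟩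
      rw [mul_neg]
      zify at this
      omega
  have hle : 1 ≤ fischerState n p d ∧ fischerState n p d ≤ n + p := by
    unfold fischerState
    split_ifs <;> omega
  have hs : (fischerState n p d < n + p ∧ fischerState n p (d + 1) = fischerState n p d + 1) ∨
      (fischerState n p d = n + p ∧ fischerState n p (d + 1) = n + 1) := by
    rcases lt_trichotomy (d + 1) n with h | h | h
    · left
      simp only [fischerState, h, show d < n by omega, if_true, and_true]
      omega
    · left
      simp only [fischerState, h, show d < n by omega, if_true, lt_irrefl, if_false, Nat.sub_self,
        Nat.zero_mod, add_zero, and_true]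
      omega
    · simp only [fischerState, show ¬ d + 1 < n by omega, show ¬ d < n by omega, if_false]
      rw [show d + 1 - n = (d - n) + 1 by omega, Nat.add_mod (d - n) 1 p]
      rcases Nat.lt_or_ge ((d - n) % p + 1) p with h' | h'
      · left
        rw [Nat.mod_eq_of_lt (a := 1) (by omega), Nat.mod_eq_of_lt h']
        omega
      · right
        have : ((d - n) % p + 1 % p) % p = 0 := by
          rw [Nat.add_mod_mod, show (d - n) % p + 1 = p by omega, Nat.mod_self]
        omega
  unfold fischerEdge
  rw [hg]
  omega

theorem fischerEdge.right_unique {a i j j' : ℕ} (h : fischerEdge g n p a i j)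
    (h' : fischerEdge g n p a i j') : j = j' := by
  unfold fischerEdge at h h'
  omega

theorem presentation_eq_add (hv : ∀ i, fischerEdge g n p (x i) (v i) (v (i + 1)))
    (hw : ∀ i, fischerEdge g n p (x i) (w i) (w (i + 1))) {t : ℤ} (h : v t = w t) (m : ℕ) :
    v (t + m) = w (t + m) := by
  induction m with
  | zero => simpa using h
  | succ m ih =>
    have h1 := hv (t + m)
    rw [ih] at h1
    have := h1.right_unique (hw (t + m))
    push_cast
    rwa [← add_assoc]

theorem presentation_eq_of_le (hv : ∀ i, fischerEdge g n p (x i) (v i) (v (i + 1)))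
    (hw : ∀ i, fischerEdge g n p (x i) (w i) (w (i + 1))) {t s : ℤ} (h : v t = w t)
    (hts : t ≤ s) : v s = w s := by
  obtain ⟨m, rfl⟩ := Int.le.dest hts
  exact presentation_eq_add hv hw h m

/-- Once `w` has visited vertex `1`, it is at vertex `1` whenever `v` is. -/
theorem presentation_sync (hn : 1 ≤ n) (hp : 1 ≤ p) (hper : ∀ k, n ≤ k → g (k + p) = g k)
    (hadm : ∀ m e, (∀ j < e, g (m + j) = g j) → g (m + e) ≤ g e)
    (hv : ∀ i, fischerEdge g n p (x i) (v i) (v (i + 1)))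
    (hw : ∀ i, fischerEdge g n p (x i) (w i) (w (i + 1))) {t s : ℤ} (hts : t ≤ s)
    (ht : w t = 1) (hs : v s = 1) : w s = 1 := by
  obtain ⟨m, rfl⟩ := Int.le.dest hts
  have key : ∀ m : ℕ, ∃ k d, v (t + m) = fischerState n p (k + d) ∧
      w (t + m) = fischerState n p d ∧ ∀ j < d, g (k + j) = g j := by
    intro m
    induction m with
    | zero =>
      refine ⟨v t - 1, 0, ?_, ?_, by omega⟩
      · have := hv t
        simpa using (fischerState_pred this.1 this.2.1).symm
      · simpa [fischerState_zero hn] using ht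
    | succ m ih =>
      obtain ⟨k, d, h1, h2, h3⟩ := ih
      have e1 := hv (t + m)
      have e2 := hw (t + m)
      rw [h1, fischerEdge_fischerState hp hper] at e1
      rw [h2, fischerEdge_fischerState hp hper] at e2
      have hle := hadm k d h3
      push_cast
      rw [← add_assoc]
      rcases e1 with ⟨e1, f1⟩ | ⟨e1, f1⟩
      · refine ⟨0, 0, ?_, ?_, by omega⟩
        · rw [f1, fischerState_zero hn]
        · rw [fischerState_zero hn]
          rcases e2 with ⟨_, f2⟩ | ⟨e2, _⟩
          · exact f2
          · omega
      · rcases e2 with ⟨e2, f2⟩ | ⟨e2, f2⟩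
        · exact ⟨k + d + 1, 0, f1, by rw [f2, fischerState_zero hn], by omega⟩
        · refine ⟨k, d + 1, f1, f2, fun j hj => ?_⟩
          rcases Nat.lt_succ_iff_lt_or_eq.1 hj with hj | rfl
          · exact h3 j hj
          · omega
  obtain ⟨k, d, h1, h2, -⟩ := key m
  have := eq_zero_of_fischerState_eq_one hn (h1.symm.trans hs)
  rw [h2, show d = 0 by omega, fischerState_zero hn]

/-- Two distinct presentations cannot both visit vertex `1` arbitrarily far to the left. -/
theorem exists_forall_le_ne_one (hn : 1 ≤ n) (hp : 1 ≤ p) (hper : ∀ k, n ≤ k → g (k + p) = g k)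
    (hadm : ∀ m e, (∀ j < e, g (m + j) = g j) → g (m + e) ≤ g e)
    (hv : ∀ i, fischerEdge g n p (x i) (v i) (v (i + 1)))
    (hw : ∀ i, fischerEdge g n p (x i) (w i) (w (i + 1))) (hne : v ≠ w) :
    (∃ T, ∀ t ≤ T, v t ≠ 1) ∨ (∃ T, ∀ t ≤ T, w t ≠ 1) := by
  by_contra! h
  apply hne
  funext i
  obtain ⟨s, hs, hs1⟩ := h.1 i
  obtain ⟨t, ht, ht1⟩ := h.2 s
  have := presentation_sync hn hp hper hadm hv hw ht ht1 hs1
  exact presentation_eq_of_le hv hw (hs1.trans this.symm) hs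

/-- A presentation that avoids vertex `1` up to time `T` runs through the cycle
`n + 1, …, n + p` up to time `T`. -/
theorem presentation_cyclic (hv : ∀ i, fischerEdge g n p (x i) (v i) (v (i + 1))) {T : ℤ}
    (hT : ∀ t ≤ T, v t ≠ 1) {t : ℤ} (ht : t ≤ T) :
    n + 1 ≤ v t ∧ v t ≤ n + p ∧ (p : ℤ) ∣ ((v t : ℤ) - t) - (v T - T) ∧
      (t < T → x t = g (v t - 1)) := by
  have hlow : ∀ t ≤ T, n + 1 ≤ v t := by
    have : ∀ k : ℕ, ∀ t ≤ T, v t = k → n + 1 ≤ k := by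
      intro k
      induction k with
      | zero => intro t _ h; have := (hv t).1; omega
      | succ k ih =>
        intro t ht h
        have h1 := hv (t - 1)
        have h2 := hT t ht
        rw [sub_add_cancel] at h1
        have h3 := ih (t - 1) (by omega)
        unfold fischerEdge at h1
        omega
    intro t ht
    exact this _ t ht rfl
  refine ⟨hlow t ht, (hv t).2.1, ?_, fun htT => ?_⟩
  · obtain ⟨m, hm⟩ := Int.le.dest ht
    obtain rfl : t = T - m := by omega
    clear hm ht
    induction m with
    | zero => simp
    | succ m ih =>
      have h1 := hv (T - m - 1)
      have h2 := hT (T - m) (by omega)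
      have h3 := hlow (T - m - 1) (by omega)
      rw [sub_add_cancel] at h1
      push_cast
      rw [show T - ((m : ℤ) + 1) = T - m - 1 by ring]
      unfold fischerEdge at h1
      obtain ⟨q, hq⟩ := ih
      rcases h1 with ⟨_, _, h1 | h1 | h1⟩
      · omega
      · exact ⟨q, by omega⟩
      · exact ⟨q + 1, by rw [mul_add, mul_one]; omega⟩
  · have h1 := hv t
    have h2 := hT (t + 1) (by omega)
    unfold fischerEdge at h1
    omega

theorem left_tail_periodic (hp : 1 ≤ p) (hv : ∀ i, fischerEdge g n p (x i) (v i) (v (i + 1)))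
    {T : ℤ} (hT : ∀ t ≤ T, v t ≠ 1) :
    ∃ k : ℤ, ∀ j : ℕ, x (k - j) = g (n + p - 1 - j % p) := by
  have hc := fun t (ht : t ≤ T) => presentation_cyclic hv hT ht
  have hTc := hc T le_rfl
  refine ⟨T - (v T - n), fun j => ?_⟩
  obtain ⟨h1, h2, h3, h4⟩ := hc (T - (v T - n) - j) (by omega)
  rw [h4 (by omega)]
  generalize v (T - (v T - n) - j) = y at *
  have hj : (p : ℤ) ∣ (j : ℤ) - (j % p : ℕ) := by
    have := Nat.div_add_mod j p
    exact ⟨(j / p : ℕ), by zify at this; push_cast; omega⟩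
  have hlt := Nat.mod_lt j hp
  have h5 : (p : ℤ) ∣ (y : ℤ) - (n + p - (j % p : ℕ)) := by
    obtain ⟨a, ha⟩ := h3
    obtain ⟨b, hb⟩ := hj
    exact ⟨a - b - 1, by rw [mul_sub, mul_sub, ← ha, ← hb]; ring⟩
  have h6 := Int.eq_zero_of_abs_lt_dvd h5 (by rw [abs_lt]; omega)
  congr 1
  omega

/-- A sequence has at most one presentation that avoids vertex `1` on the left. -/
theorem cyclic_presentation_unique (hper : ∀ k, n ≤ k → g (k + p) = g k)
    (hmin : ∀ q, 1 ≤ q → (∀ k, n ≤ k → g (k + q) = g k) → p ≤ q)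
    (hp : 1 ≤ p)
    (hv : ∀ i, fischerEdge g n p (x i) (v i) (v (i + 1)))
    (hw : ∀ i, fischerEdge g n p (x i) (w i) (w (i + 1)))
    (hv1 : ∃ T, ∀ t ≤ T, v t ≠ 1) (hw1 : ∃ T, ∀ t ≤ T, w t ≠ 1) : v = w := by
  obtain ⟨T₁, hT₁⟩ := hv1
  obtain ⟨T₂, hT₂⟩ := hw1
  funext i
  by_contra hi
  obtain ⟨T, hTi, hT1, hT2⟩ : ∃ T, T ≤ i ∧ T ≤ T₁ ∧ T ≤ T₂ :=
    ⟨min i (min T₁ T₂), by omega, by omega, by omega⟩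
  have hne : v T ≠ w T := fun h => hi (presentation_eq_of_le hv hw h hTi)
  replace hT₁ : ∀ t ≤ T, v t ≠ 1 := fun t ht => hT₁ t (by omega)
  replace hT₂ : ∀ t ≤ T, w t ≠ 1 := fun t ht => hT₂ t (by omega)
  clear hi hT1 hT2
  wlog hlt : w T < v T generalizing v w
  · exact this hw hv hne.symm hT₂ hT₁ (by omega)
  have hvT := presentation_cyclic hv hT₁ le_rfl
  have hwT := presentation_cyclic hw hT₂ le_rfl
  have := hmin (v T - w T) (by omega) fun k hk => ?_
  · omega
  have hM : (k : ℤ) + 1 ≤ p * (k + 1) := by nlinarith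
  obtain ⟨t, ht⟩ : ∃ t : ℤ, t = k + 1 - w T + T - p * (k + 1) := ⟨_, rfl⟩
  have htT : t < T := by omega
  obtain ⟨a1, a2, a3, a4⟩ := presentation_cyclic hv hT₁ htT.le
  obtain ⟨b1, b2, b3, b4⟩ := presentation_cyclic hw hT₂ htT.le
  calc g (k + (v T - w T)) = g (v t - 1) := by
        refine apply_eq_of_dvd_sub hper (by omega) (by omega) ?_
        obtain ⟨a, ha⟩ := a3
        refine ⟨k + 1 - a, ?_⟩
        rw [mul_sub, ← ha]
        push_cast [hlt.le, show 1 ≤ v t by omega]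
        omega
    _ = g (w t - 1) := by rw [← a4 htT, ← b4 htT]
    _ = g k := by
        refine apply_eq_of_dvd_sub hper (by omega) hk ?_
        obtain ⟨b, hb⟩ := b3
        refine ⟨b - (k + 1), ?_⟩
        rw [mul_sub, ← hb]
        push_cast [show 1 ≤ w t by omega]
        omega

/-- The periodic point `(g_{n+1} ⋯ g_{n+p})^∞` is presented by the cycle `n + 1, …, n + p`. -/
theorem cycle_presents (hp : 1 ≤ p) (hper : ∀ k, n ≤ k → g (k + p) = g k) (i : ℤ) :
    fischerEdge g n p (g (n + (i % (p : ℤ)).toNat)) (n + 1 + (i % (p : ℤ)).toNat)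
      (n + 1 + ((i + 1) % (p : ℤ)).toNat) := by
  have h0 := Int.emod_nonneg i (show (p : ℤ) ≠ 0 by omega)
  have h1 := Int.emod_lt_of_pos i (show (0 : ℤ) < p by omega)
  have h2 : n + 1 + (i % (p : ℤ)).toNat = fischerState n p (n + (i % (p : ℤ)).toNat) := by
    simp only [fischerState, show ¬ n + (i % (p : ℤ)).toNat < n by omega, if_false,
      Nat.add_sub_cancel_left]
    rw [Nat.mod_eq_of_lt (by omega)]
  rw [h2, fischerEdge_fischerState hp hper]
  refine Or.inr ⟨rfl, ?_⟩
  simp only [fischerState, show ¬ n + (i % (p : ℤ)).toNat + 1 < n by omega, if_false]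
  congr 1
  rw [show n + (i % (p : ℤ)).toNat + 1 - n = (i % (p : ℤ)).toNat + 1 by omega]
  have h3 : (((i % (p : ℤ)).toNat + 1 : ℕ) : ℤ) = i % p + 1 := by omega
  zify
  rw [Int.toNat_of_nonneg (Int.emod_nonneg _ (by omega)), Int.toNat_of_nonneg h0]
  simp

/-- The periodic point `(g_{n+1} ⋯ g_{n+p})^∞` has a presentation through vertex `1`, whose
vertex at time `i` records the longest prefix of `g` ending at position `i`. -/
theorem exists_presentation_eq_one (hn : 1 ≤ n) (hp : 1 ≤ p)
    (hper : ∀ k, n ≤ k → g (k + p) = g k)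
    (hadm : ∀ m e, (∀ j < e, g (m + j) = g j) → g (m + e) ≤ g e)
    (hnp : ∀ q, 1 ≤ q → ¬ ∀ k, g (k + q) = g k) :
    ∃ v : ℤ → ℕ, (∀ i : ℤ, fischerEdge g n p (g (n + (i % (p : ℤ)).toNat)) (v i) (v (i + 1))) ∧
      ∃ i, v i = 1 := by
  obtain ⟨x, hx⟩ : ∃ x : ℤ → ℕ, ∀ i, x i = g (n + (i % (p : ℤ)).toNat) := ⟨_, fun _ => rfl⟩
  simp only [← hx]
  have hxg : ∀ (t : ℤ) (j : ℕ), x (t + j) = g (n + (t % (p : ℤ)).toNat + j) := by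
    intro t j
    rw [hx]
    refine apply_eq_of_dvd_sub hper (by omega) (by omega) ?_
    push_cast
    rw [Int.toNat_of_nonneg (Int.emod_nonneg _ (by omega)),
      Int.toNat_of_nonneg (Int.emod_nonneg _ (by omega))]
    have e1 := Int.mul_ediv_add_emod (t + j) p
    have e2 := Int.mul_ediv_add_emod t p
    refine ⟨t / p - (t + j) / p, ?_⟩
    rw [mul_sub]
    omega
  let M : ℤ → ℕ → Prop := fun i d => ∀ j < d, x (i - d + j) = g j
  have hM0 : ∀ i, M i 0 := fun i j hj => absurd hj (by omega)
  have hMs : ∀ i d, M (i + 1) (d + 1) ↔ M i d ∧ x i = g d := by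
    intro i d
    have e : i + 1 - ((d + 1 : ℕ) : ℤ) = i - d := by push_cast; ring
    simp only [M, e]
    constructor
    · intro h
      exact ⟨fun j hj => h j (by omega), by simpa using h d (by omega)⟩
    · rintro ⟨h, h'⟩ j hj
      rcases Nat.lt_succ_iff_lt_or_eq.1 hj with hj | rfl
      · exact h j hj
      · simpa using h'
  have hMle : ∀ i d, M i d → x i ≤ g d := by
    intro i d h
    have e : x i = g (n + ((i - d) % (p : ℤ)).toNat + d) := by
      rw [← hxg, sub_add_cancel]
    rw [e]
    refine hadm _ _ fun j hj => ?_
    rw [← hxg, h j hj]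
  have hMM : ∀ i d e, M i d → M i e → e ≤ d → g d ≤ g e := by
    intro i d e hd he hed
    have := hadm (d - e) e fun j hj => ?_
    · rwa [Nat.sub_add_cancel hed] at this
    · rw [← he j hj, ← hd (d - e + j) (by omega)]
      congr 1
      push_cast [hed]
      ring
  obtain ⟨B, hB⟩ : ∃ B, ∀ i d, M i d → d ≤ B := by
    have : ∀ q : ℕ, ∃ k, 1 ≤ q → g (k + q) ≠ g k := by
      intro q
      by_cases hq : 1 ≤ q
      · have := hnp q hq
        push Not at this
        obtain ⟨k, hk⟩ := this
        exact ⟨k, fun _ => hk⟩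
      · exact ⟨0, fun h => absurd h hq⟩
    choose N hN using this
    refine ⟨(Finset.range (n + p)).sup N, fun i d h => ?_⟩
    have h1 := Int.emod_lt_of_pos (i - d) (show (0 : ℤ) < p by omega)
    have hle : N (n + ((i - d) % (p : ℤ)).toNat) ≤ (Finset.range (n + p)).sup N :=
      Finset.le_sup (Finset.mem_range.2 (by omega))
    by_contra hlt
    refine hN (n + ((i - d) % (p : ℤ)).toNat) (by omega) ?_
    rw [add_comm, ← hxg, h _ (by omega)]
  have hD : ∀ i, ∃ d, M i d ∧ ∀ e, M i e → e ≤ d := by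
    intro i
    classical
    exact ⟨Nat.findGreatest (M i) B, Nat.findGreatest_spec (Nat.zero_le _) (hM0 i),
      fun e he => Nat.le_findGreatest (hB i e he) he⟩
  choose D hDM hDmax using hD
  have hstep : ∀ i, (x i < g (D i) ∧ D (i + 1) = 0) ∨ (x i = g (D i) ∧ D (i + 1) = D i + 1) := by
    intro i
    have hpred : ∀ e, D (i + 1) = e + 1 → e ≤ D i ∧ x i = g e ∧ g (D i) ≤ g e := by
      intro e he
      have := hDM (i + 1)
      rw [he, hMs] at this
      have hle := hDmax i e this.1
      exact ⟨hle, this.2, hMM i _ _ (hDM i) this.1 hle⟩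
    rcases (hMle i _ (hDM i)).lt_or_eq with h | h
    · refine Or.inl ⟨h, ?_⟩
      by_contra h0
      obtain ⟨e, he⟩ := Nat.exists_eq_succ_of_ne_zero h0
      have := hpred e he
      omega
    · refine Or.inr ⟨h, ?_⟩
      have h1 := hDmax (i + 1) _ ((hMs i (D i)).2 ⟨hDM i, h⟩)
      have h2 := hpred (D (i + 1) - 1) (by omega)
      omega
  refine ⟨fun i => fischerState n p (D i), fun i => ?_, ?_⟩
  · refine (fischerEdge_fischerState hp hper).2 ?_
    rcases hstep i with ⟨h1, h2⟩ | ⟨h1, h2⟩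
    · exact Or.inl ⟨h1, by simp only [h2, fischerState_zero hn]⟩
    · exact Or.inr ⟨h1, by simp only [h2]⟩
  · by_contra! hne
    have hgrow : ∀ m : ℕ, D m = D 0 + m := by
      intro m
      induction m with
      | zero => simp
      | succ m ih =>
        rcases hstep m with ⟨_, h2⟩ | ⟨_, h2⟩
        · exact absurd (by rw [h2, fischerState_zero hn]) (hne (m + 1))
        · push_cast
          omega
    have h1 := hgrow (B + 1)
    have h2 := hB _ _ (hDM ((B + 1 : ℕ) : ℤ))
    omega

/-- Among three presentations of a sequence, two coincide. -/
theorem presentation_eq_or_eq_or_eq (hn : 1 ≤ n) (hp : 1 ≤ p)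
    (hper : ∀ k, n ≤ k → g (k + p) = g k)
    (hadm : ∀ m e, (∀ j < e, g (m + j) = g j) → g (m + e) ≤ g e)
    (hmin : ∀ q, 1 ≤ q → (∀ k, n ≤ k → g (k + q) = g k) → p ≤ q) {u : ℤ → ℕ}
    (hu : ∀ i, fischerEdge g n p (x i) (u i) (u (i + 1)))
    (hv : ∀ i, fischerEdge g n p (x i) (v i) (v (i + 1)))
    (hw : ∀ i, fischerEdge g n p (x i) (w i) (w (i + 1))) : u = v ∨ u = w ∨ v = w := by
  by_contra! h
  obtain ⟨huv, huw, hvw⟩ := h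
  have a := exists_forall_le_ne_one hn hp hper hadm hu hv huv
  have b := exists_forall_le_ne_one hn hp hper hadm hu hw huw
  have c := exists_forall_le_ne_one hn hp hper hadm hv hw hvw
  have a' := cyclic_presentation_unique hper hmin hp hu hv
  have b' := cyclic_presentation_unique hper hmin hp hu hw
  have c' := cyclic_presentation_unique hper hmin hp hv hw
  tauto

end FischerGraph

/-- let `g(β)` be eventually periodic but not periodic, with minimal `n ≥ 1`
and `p ≥ 1`.  Then (a) every `x ∈ X_β` admits at most two presentations in `F_β`;
(b) if `x` admits two distinct presentations then some left tail of `x` is the left-infinite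
periodic word `(g_{n+1} ⋯ g_{n+p})^∞`; and (c) the bi-infinite periodic point
`x_i = g_{n+1+(i mod p)}` admits exactly two presentations. -/
theorem statement9 (β : ℝ) (hβ : 1 < β) (n p : ℕ) (hn : 1 ≤ n) (hp : 1 ≤ p)
    (hper : ∀ k, n ≤ k → genSeq β (k + p) = genSeq β k)
    (hmin : ∀ n' p' : ℕ, 1 ≤ p' →
      (∀ k, n' ≤ k → genSeq β (k + p') = genSeq β k) → n ≤ n' ∧ p ≤ p') :
    (∀ x : ℤ → ℕ, memBeta β x → ∀ v₁ v₂ v₃ : ℤ → ℕ,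
      (∀ i : ℤ, fischerEdge (genSeq β) n p (x i) (v₁ i) (v₁ (i + 1))) →
      (∀ i : ℤ, fischerEdge (genSeq β) n p (x i) (v₂ i) (v₂ (i + 1))) →
      (∀ i : ℤ, fischerEdge (genSeq β) n p (x i) (v₃ i) (v₃ (i + 1))) →
      v₁ = v₂ ∨ v₁ = v₃ ∨ v₂ = v₃) ∧
    (∀ x : ℤ → ℕ, memBeta β x → ∀ v₁ v₂ : ℤ → ℕ,
      (∀ i : ℤ, fischerEdge (genSeq β) n p (x i) (v₁ i) (v₁ (i + 1))) →
      (∀ i : ℤ, fischerEdge (genSeq β) n p (x i) (v₂ i) (v₂ (i + 1))) →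
      v₁ ≠ v₂ →
      ∃ k : ℤ, ∀ j : ℕ, x (k - j) = genSeq β (n + p - 1 - j % p)) ∧
    (∃ v₁ v₂ : ℤ → ℕ, v₁ ≠ v₂ ∧
      (∀ i : ℤ, fischerEdge (genSeq β) n p
        (genSeq β (n + (i % (p : ℤ)).toNat)) (v₁ i) (v₁ (i + 1))) ∧
      (∀ i : ℤ, fischerEdge (genSeq β) n p
        (genSeq β (n + (i % (p : ℤ)).toNat)) (v₂ i) (v₂ (i + 1))) ∧
      ∀ v : ℤ → ℕ,
        (∀ i : ℤ, fischerEdge (genSeq β) n p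
          (genSeq β (n + (i % (p : ℤ)).toNat)) (v i) (v (i + 1))) →
        v = v₁ ∨ v = v₂) := by
  have hnp : ∀ q, 1 ≤ q → ¬ ∀ k, genSeq β (k + q) = genSeq β k := fun q hq h => by
    have := (hmin 0 q hq fun k _ => h k).1
    omega
  have hadm : ∀ m e, (∀ j < e, genSeq β (m + j) = genSeq β j) →
      genSeq β (m + e) ≤ genSeq β e := by
    rw [genSeq_eq_betaDigit hnp]
    exact betaDigit_add_le hβ
  have hmin' := fun q hq h => (hmin n q hq h).2
  refine ⟨fun x _ v₁ v₂ v₃ h₁ h₂ h₃ =>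
    presentation_eq_or_eq_or_eq hn hp hper hadm hmin' h₁ h₂ h₃, fun x _ v₁ v₂ h₁ h₂ hne => ?_, ?_⟩
  · rcases exists_forall_le_ne_one hn hp hper hadm h₁ h₂ hne with ⟨T, hT⟩ | ⟨T, hT⟩
    · exact left_tail_periodic hp h₁ hT
    · exact left_tail_periodic hp h₂ hT
  · obtain ⟨w, hw, i, hi⟩ := exists_presentation_eq_one hn hp hper hadm hnp
    have hc := cycle_presents hp hper
    have hne : (fun i : ℤ => n + 1 + (i % (p : ℤ)).toNat) ≠ w := by
      intro h
      have := congrFun h i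
      omega
    refine ⟨_, w, hne, hc, hw, fun v hv => ?_⟩
    rcases presentation_eq_or_eq_or_eq (x := fun i => genSeq β (n + (i % (p : ℤ)).toNat))
      hn hp hper hadm hmin' hv hc hw with h | h | h
    · exact Or.inl h
    · exact Or.inr h
    · exact absurd h hne
end
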